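/- For every t > 0 there exists s₀ > 0 such that for all s ≥ s₀: G_M(s) = (2√2·c_H/s) · ∫₀^π ∫_J ∫_Y 1[𝓛' ∩ (y₁⁻¹ℓ₁(θ₁) × y₂⁻¹ℓ₂(θ₂)) = ∅] · (y₁y₂)⁻³ dy₁ dy₂ dθ₁ dθ₂, where J = [0,π/4] ∪ [3π/4,π), Y = {(y₁,y₂) : y₁ > 0, 1 < y₂ < λ²}, ℓ₁(θ₁) ⊂ ℝ is the image under projection to the first coordinate of θ̂^{−1/2}·T₁·k(−θ₁) with T₁ the open triangle with vertices (0,0), (1,1), (1,−1), and ℓ₂(θ₂) ⊂ ℝ is the image under projection to the first coordinate of 𝒲·k(−θ₂). -/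

import Mathlib

open MeasureTheory Matrix Set Pointwise

noncomputable section

/-- The real embedding of `ℤ[√2]`, `a + b√2 ↦ a + b√2`. -/
def emb (α : Zsqrtd 2) : ℝ := (α.re : ℝ) + (α.im : ℝ) * Real.sqrt 2

/-- The Galois-conjugate embedding `σ`, `a + b√2 ↦ a − b√2`. -/
def embc (α : Zsqrtd 2) : ℝ := (α.re : ℝ) - (α.im : ℝ) * Real.sqrt 2

/-- The fundamental unit `λ = 1 + √2`. -/
def lam : ℝ := 1 + Real.sqrt 2

/-- `𝓛'`: the Minkowski embedding of `ℤ[√2]` in `ℝ²`. -/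
def Lp : Set (ℝ × ℝ) := {p | ∃ α : Zsqrtd 2, p = (emb α, embc α)}

/-- `v(β₁,β₂) = (β₁, β₂, σ(β₁), σ(β₂))`. -/
def latvec (β₁ β₂ : Zsqrtd 2) : Fin 4 → ℝ := ![emb β₁, emb β₂, embc β₁, embc β₂]

/-- `𝓛`: the Minkowski embedding of `ℤ[√2]²` in `ℝ⁴`. -/
def Lquad : Set (Fin 4 → ℝ) := {v | ∃ β₁ β₂ : Zsqrtd 2, v = latvec β₁ β₂}

/-- `𝓛h`, for a 4×4 real matrix `h` (row vectors, right multiplication). -/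
def latimage (h : Matrix (Fin 4) (Fin 4) ℝ) : Set (Fin 4 → ℝ) :=
  (fun v => Matrix.vecMul v h) '' Lquad

def nmat (x : ℝ) : Matrix (Fin 2) (Fin 2) ℝ := !![1, x; 0, 1]
def amat (y : ℝ) : Matrix (Fin 2) (Fin 2) ℝ := !![y, 0; 0, y⁻¹]
def kmat (θ : ℝ) : Matrix (Fin 2) (Fin 2) ℝ :=
  !![Real.cos θ, -Real.sin θ; Real.sin θ, Real.cos θ]

/-- Block diagonal 4×4 matrix from two 2×2 blocks. -/
def bd (A B : Matrix (Fin 2) (Fin 2) ℝ) : Matrix (Fin 4) (Fin 4) ℝ :=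
  !![A 0 0, A 0 1, 0, 0;
     A 1 0, A 1 1, 0, 0;
     0, 0, B 0 0, B 0 1;
     0, 0, B 1 0, B 1 1]

/-- `h(x₁,x₂,y₁,y₂,θ₁,θ₂) = diag(n(x₁)a(y₁)k(θ₁), n(x₂)a(y₂)k(θ₂))`. -/
def hmat (x₁ x₂ y₁ y₂ θ₁ θ₂ : ℝ) : Matrix (Fin 4) (Fin 4) ℝ :=
  bd (nmat x₁ * amat y₁ * kmat θ₁) (nmat x₂ * amat y₂ * kmat θ₂)

/-- `H = SL₂(ℝ)² ⊂ SL₄(ℝ)` (block diagonal). -/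
def Hset : Set (Matrix (Fin 4) (Fin 4) ℝ) :=
  {h | ∃ A B : Matrix (Fin 2) (Fin 2) ℝ, A.det = 1 ∧ B.det = 1 ∧ h = bd A B}

/-- `Γ_K = {diag(A, σ(A)) : A ∈ SL₂(ℤ[√2])}`. -/
def GammaK : Set (Matrix (Fin 4) (Fin 4) ℝ) :=
  {g | ∃ A : Matrix (Fin 2) (Fin 2) (Zsqrtd 2), A.det = 1 ∧ g = bd (A.map emb) (A.map embc)}

/-- `𝒲`: the open regular octagon of side length √2. -/
def Woct : Set (ℝ × ℝ) :=
  {p | |p.1| < lam / Real.sqrt 2 ∧ |p.2| < lam / Real.sqrt 2 ∧ |p.1| + |p.2| < lam}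

/-- `𝒲' = 𝒲 ∖ (√2−1)𝒲`. -/
def Wp : Set (ℝ × ℝ) := Woct \ ((Real.sqrt 2 - 1) • Woct)

/-- `θ̂ = 48√2/π⁴`, the density of visible points. -/
def thetaHat : ℝ := 48 * Real.sqrt 2 / Real.pi ^ 4

/-- `T(s)`: open triangle with vertices `(0,0)`, `(s/θ̂)^{1/2}(1,±1)`. -/
def Tset (s : ℝ) : Set (ℝ × ℝ) :=
  {p | 0 < p.1 ∧ p.1 < Real.sqrt (s / thetaHat) ∧ |p.2| < p.1}

/-- `𝔉`: a fundamental domain of `𝓛'`. -/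
def Fdom : Set (ℝ × ℝ) :=
  {p | ∃ r₁ ∈ Set.Ico (0:ℝ) 1, ∃ r₂ ∈ Set.Ico (0:ℝ) 1,
    p = (1 + r₁ + r₂ * Real.sqrt 2, 2 + r₁ - r₂ * Real.sqrt 2)}

/-- The Siegel domain `𝔇_t`. -/
def Dset (t : ℝ) : Set (Matrix (Fin 4) (Fin 4) ℝ) :=
  {h | ∃ x₁ x₂ y₁ y₂ θ₁ θ₂ : ℝ, (x₁, x₂) ∈ Fdom ∧ 0 < y₁ ∧ 0 < y₂ ∧ t ≤ y₁ * y₂ ∧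
    lam ^ (-2 : ℤ) ≤ y₁ / y₂ ∧ y₁ / y₂ ≤ lam ^ 2 ∧
    θ₁ ∈ Set.Ico 0 Real.pi ∧ θ₂ ∈ Set.Ico 0 Real.pi ∧ h = hmat x₁ x₂ y₁ y₂ θ₁ θ₂}

/-- Row vector times 2×2 matrix, on `ℝ × ℝ`. -/
def mul2 (p : ℝ × ℝ) (M : Matrix (Fin 2) (Fin 2) ℝ) : ℝ × ℝ :=
  (p.1 * M 0 0 + p.2 * M 1 0, p.1 * M 0 1 + p.2 * M 1 1)

/-- `r(s)`: the unique integer with `λ^{2r} ≤ s^{1/4} < λ^{2(r+1)}`. -/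
def rr (s : ℝ) : ℤ := ⌊Real.logb (lam ^ 2) (s ^ ((1:ℝ)/4))⌋

/-- `𝒯(s)` with explicit integer `r`: `λ^{−2r}T(s) × λ^{2r}𝒲`. -/
def calT (s : ℝ) (r : ℤ) : Set (Fin 4 → ℝ) :=
  {v | (lam ^ (2*r) * v 0, lam ^ (2*r) * v 1) ∈ Tset s ∧
       (lam ^ (-(2*r)) * v 2, lam ^ (-(2*r)) * v 3) ∈ Woct}

/-- `𝒯(s) = λ^{−2r(s)}T(s) × λ^{2r(s)}𝒲`. -/
def calTs (s : ℝ) : Set (Fin 4 → ℝ) := calT s (rr s)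

/-- Euclidean norm on `ℝ⁴`. -/
def enorm4 (v : Fin 4 → ℝ) : ℝ := Real.sqrt (∑ i, (v i) ^ 2)

/-- `𝓛h̃ = (ℤ(y₁,0,y₂,0) + ℤ√2(y₁,0,−y₂,0) + ℝ(0,1,0,0) + ℝ(0,0,0,1))·diag(k(θ₁),k(θ₂))`. -/
def Ltilde (y₁ y₂ θ₁ θ₂ : ℝ) : Set (Fin 4 → ℝ) :=
  {v | ∃ (m n : ℤ) (c₁ c₂ : ℝ),
    v = Matrix.vecMul ![((m:ℝ) + (n:ℝ) * Real.sqrt 2) * y₁, c₁,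
          ((m:ℝ) - (n:ℝ) * Real.sqrt 2) * y₂, c₂] (bd (kmat θ₁) (kmat θ₂))}

open Classical in
/-- Real-valued indicator of a proposition. -/
def ind (P : Prop) : ℝ := if P then 1 else 0

/-- `c_H = 3/π⁴`. -/
def cH : ℝ := 3 / Real.pi ^ 4

/-- `Y_t = {(y₁,y₂) : y₁,y₂ > 0, y₁y₂ ≥ t, y₁/y₂ ∈ (λ⁻²,λ²)}`. -/
def Yt (t : ℝ) : Set (ℝ × ℝ) :=
  {y | 0 < y.1 ∧ 0 < y.2 ∧ t ≤ y.1 * y.2 ∧ lam ^ (-2:ℤ) < y.1 / y.2 ∧ y.1 / y.2 < lam ^ 2}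

/-- The main term `G_M(s)` (depending on the Siegel-domain parameter `t`). -/
def GM (t s : ℝ) : ℝ :=
  cH * ∫ θ₂ in Set.Ico (0:ℝ) Real.pi, ∫ θ₁ in Set.Ico (0:ℝ) Real.pi, ∫ y in Yt t, ∫ x in Fdom,
    (y.1 ^ 3 * y.2 ^ 3)⁻¹ * ind (Ltilde y.1 y.2 θ₁ θ₂ ∩ calTs s = ∅)

/-- The error term `G_E(s)`. -/
def GE (t s : ℝ) : ℝ :=
  cH * ∫ θ₂ in Set.Ico (0:ℝ) Real.pi, ∫ θ₁ in Set.Ico (0:ℝ) Real.pi, ∫ y in Yt t, ∫ x in Fdom,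
    (y.1 ^ 3 * y.2 ^ 3)⁻¹ *
      ind (latimage (hmat x.1 x.2 y.1 y.2 θ₁ θ₂) ∩ calTs s = ∅ ∧
           (Ltilde y.1 y.2 θ₁ θ₂ ∩ calTs s).Nonempty)

/-- `J = [0,π/4] ∪ [3π/4,π)`. -/
def Jset : Set ℝ := Set.Icc 0 (Real.pi/4) ∪ Set.Ico (3*Real.pi/4) Real.pi

/-- `Y = {(y₁,y₂) : y₁ > 0, 1 < y₂ < λ²}`. -/
def Yset : Set (ℝ × ℝ) := {y | 0 < y.1 ∧ 1 < y.2 ∧ y.2 < lam ^ 2}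

/-- `T₁`: open triangle with vertices `(0,0)`, `(1,±1)`. -/
def T1 : Set (ℝ × ℝ) := {p | 0 < p.1 ∧ p.1 < 1 ∧ |p.2| < p.1}

/-- `ℓ₁(θ₁)`: first-coordinate projection of `θ̂^{−1/2}T₁k(−θ₁)`. -/
def ell1 (θ₁ : ℝ) : Set ℝ :=
  {x | ∃ p ∈ T1, x = (mul2 ((Real.sqrt thetaHat)⁻¹ • p) (kmat (-θ₁))).1}

/-- `ℓ₂(θ₂)`: first-coordinate projection of `𝒲k(−θ₂)`. -/
def ell2 (θ₂ : ℝ) : Set ℝ := {x | ∃ p ∈ Woct, x = (mul2 p (kmat (-θ₂))).1}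

/-- `C_𝒫 = 2304(2−√2)/π⁸`. -/
def CP : ℝ := 2304 * (2 - Real.sqrt 2) / Real.pi ^ 8

/-- `ζ_K(2) = π⁴/(48√2)`. -/
def zetaK2 : ℝ := Real.pi ^ 4 / (48 * Real.sqrt 2)

/-- `𝒯'(s) = T(s) × 𝒲`. -/
def Tprime (s : ℝ) : Set (Fin 4 → ℝ) :=
  {v | (v 0, v 1) ∈ Tset s ∧ (v 2, v 3) ∈ Woct}

/-- `L₁(θ₁)` from Lemma 3.4: projection of `λ^{−2r}T(s)k(−θ₁)` onto the x-axis. -/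
def L1set (s : ℝ) (r : ℤ) (θ₁ : ℝ) : Set ℝ :=
  {x | ∃ p ∈ Tset s, x = (mul2 ((lam ^ (-(2*r)) : ℝ) • p) (kmat (-θ₁))).1}

/-- `L₂(θ₂)`: projection of `λ^{2r}𝒲k(−θ₂)` onto the x-axis. -/
def L2set (r : ℤ) (θ₂ : ℝ) : Set ℝ :=
  {x | ∃ p ∈ Woct, x = (mul2 ((lam ^ (2*r) : ℝ) • p) (kmat (-θ₂))).1}

/-- `n(x)a(y)k(θ)` where `y,θ` are determined by `y⁻¹(sin θ, cos θ) = z`. -/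
def hz (z : ℝ × ℝ) (x : ℝ) : Matrix (Fin 2) (Fin 2) ℝ :=
  nmat x * amat (Real.sqrt (z.1 ^ 2 + z.2 ^ 2))⁻¹ *
    !![(Real.sqrt (z.1 ^ 2 + z.2 ^ 2))⁻¹ * z.2, -((Real.sqrt (z.1 ^ 2 + z.2 ^ 2))⁻¹ * z.1);
       (Real.sqrt (z.1 ^ 2 + z.2 ^ 2))⁻¹ * z.1, (Real.sqrt (z.1 ^ 2 + z.2 ^ 2))⁻¹ * z.2]

/-- The function `F₂` of Lemma 4.7. -/
def F2 (z₁ : ℝ) : ℝ :=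
  (24 / Real.pi ^ 4) * ∫ z₂ in Set.Ioo (-z₁) z₁, ∫ w in Wp, ∫ x in Fdom,
    ind (latimage (bd (hz (z₁, z₂) x.1) (hz w x.2)) ∩ Tprime (z₁ ^ 2 * thetaHat) = ∅)

/-- The box `B(α₃,α₄)`. -/
def Bbox (α₃ α₄ : Zsqrtd 2) (C₁ s : ℝ) : Set (ℝ × ℝ) :=
  {x | |x.1 + emb α₄ / emb α₃| ≤ C₁ / Real.sqrt s ∧
       |x.2 + embc α₄ / embc α₃| ≤ C₁ / Real.sqrt s}

/-- The matrix `h` determined by `s, z₂, w, x₁, x₂` via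
`y₁⁻¹(sin θ₁, cos θ₁) = λ^{−2r}(θ̂^{−1/2}s^{1/2}, z₂)`, `y₂⁻¹(sin θ₂, cos θ₂) = λ^{2r}w`. -/
def hfull (s z₂ : ℝ) (w : ℝ × ℝ) (x₁ x₂ : ℝ) : Matrix (Fin 4) (Fin 4) ℝ :=
  bd (hz ((lam ^ (-(2 * rr s)) : ℝ) • (Real.sqrt (s / thetaHat), z₂)) x₁)
     (hz ((lam ^ (2 * rr s) : ℝ) • w) x₂)

/-- `F⁺_{(α₃,α₄)}(s)`. -/
def Fplus (α₃ α₄ : Zsqrtd 2) (C₁ s : ℝ) : ℝ :=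
  (Real.sqrt s)⁻¹ * ∫ z₂ in Set.Ioo (0:ℝ) (Real.sqrt (s / thetaHat)), ∫ w in Wp,
    ∫ x in Bbox α₃ α₄ C₁ s, ind (latimage (hfull s z₂ w x.1 x.2) ∩ calTs s = ∅)

/-- `F⁻_{(α₃,α₄)}(s)`. -/
def Fminus (α₃ α₄ : Zsqrtd 2) (C₁ s : ℝ) : ℝ :=
  (Real.sqrt s)⁻¹ * ∫ z₂ in Set.Ioo (-Real.sqrt (s / thetaHat)) (0:ℝ), ∫ w in Wp,
    ∫ x in Bbox α₃ α₄ C₁ s, ind (latimage (hfull s z₂ w x.1 x.2) ∩ calTs s = ∅)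

/-- `F_{(α₃,α₄)}(s)`. -/
def Ffull (α₃ α₄ : Zsqrtd 2) (C₁ s : ℝ) : ℝ :=
  (Real.sqrt s)⁻¹ *
    ∫ z₂ in Set.Ioo (-Real.sqrt (s / thetaHat)) (Real.sqrt (s / thetaHat)), ∫ w in Wp,
      ∫ x in Bbox α₃ α₄ C₁ s, ind (latimage (hfull s z₂ w x.1 x.2) ∩ calTs s = ∅)

/-- `v₁ = (α₃, α₄, σ(α₃), σ(α₄))`. -/
def vv1 (α₃ α₄ : Zsqrtd 2) : Fin 4 → ℝ := ![emb α₃, emb α₄, embc α₃, embc α₄]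

/-- `v₂ = (√2α₃, √2α₄, −√2σ(α₃), −√2σ(α₄))`. -/
def vv2 (α₃ α₄ : Zsqrtd 2) : Fin 4 → ℝ :=
  ![Real.sqrt 2 * emb α₃, Real.sqrt 2 * emb α₄,
    -(Real.sqrt 2 * embc α₃), -(Real.sqrt 2 * embc α₄)]

/-- `b₁ = (α₃, α₄, 0, 0)`. -/
def bb1 (α₃ α₄ : Zsqrtd 2) : Fin 4 → ℝ := ![emb α₃, emb α₄, 0, 0]

/-- `b₂ = (0, 0, σ(α₃), σ(α₄))`. -/
def bb2 (α₃ α₄ : Zsqrtd 2) : Fin 4 → ℝ := ![0, 0, embc α₃, embc α₄]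

/-- The subgrid `𝓛_v = v + ℤv₁ + ℤv₂`. -/
def Lv (α₃ α₄ : Zsqrtd 2) (v : Fin 4 → ℝ) : Set (Fin 4 → ℝ) :=
  {u | ∃ m n : ℤ, u = v + (m:ℝ) • vv1 α₃ α₄ + (n:ℝ) • vv2 α₃ α₄}

/-- The filled plane `Π_v = v + ℝb₁ + ℝb₂`. -/
def Piv (α₃ α₄ : Zsqrtd 2) (v : Fin 4 → ℝ) : Set (Fin 4 → ℝ) :=
  {u | ∃ c₁ c₂ : ℝ, u = v + c₁ • bb1 α₃ α₄ + c₂ • bb2 α₃ α₄}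

/-- `d(s) = θ̂^{−1/2}λ^{−2r}s^{1/2}`. -/
def ds (s : ℝ) : ℝ := lam ^ (-(2 * rr s)) * Real.sqrt (s / thetaHat)

/-- The explicit integral representation `Φ(s)` of the limiting gap distribution `F(s)`. -/
def Phi (s : ℝ) : ℝ :=
  (1 / ((2:ℝ) ^ ((11:ℝ)/2) * Real.sqrt thetaHat * zetaK2 * Real.sqrt s)) *
    ∫ z₂ in Set.Ioo (-Real.sqrt (s / thetaHat)) (Real.sqrt (s / thetaHat)), ∫ w in Wp,
      ∫ x in Fdom, ind (latimage (hfull s z₂ w x.1 x.2) ∩ calTs s = ∅)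


section FundamentalDomain

theorem mem_and_level_zpow {X : Type*} {e : Equiv.Perm X} {S : Set X} {φ : X → ℝ} {p : ℝ}
    (hS : ∀ x, e x ∈ S ↔ x ∈ S) (hφ : ∀ x ∈ S, φ (e x) = φ x + p) (n : ℤ) :
    ∀ x ∈ S, (e ^ n) x ∈ S ∧ φ ((e ^ n) x) = φ x + n * p := by
  induction n using Int.induction_on with
  | zero => intro x hx; simpa using hx
  | succ n ih =>
    intro x hx
    rw [_root_.zpow_add_one, Equiv.Perm.mul_apply]
    obtain ⟨h1, h2⟩ := ih (e x) ((hS x).2 hx)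
    refine ⟨h1, ?_⟩
    rw [h2, hφ x hx]
    push_cast
    ring
  | pred n ih =>
    intro x hx
    have he : e (e⁻¹ x) = x := e.apply_symm_apply x
    have hx' : e⁻¹ x ∈ S := by
      rw [← hS, he]
      exact hx
    rw [_root_.zpow_sub_one, Equiv.Perm.mul_apply]
    obtain ⟨h1, h2⟩ := ih (e⁻¹ x) hx'
    refine ⟨h1, ?_⟩
    have h3 := hφ _ hx'
    rw [he] at h3
    rw [h2, h3]
    push_cast
    ring

variable {X : Type*} [MeasurableSpace X]

theorem measurePreserving_zpow {μ : Measure X} (e : X ≃ᵐ X) (he : MeasurePreserving e μ μ) (n : ℤ) :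
    MeasurePreserving ((e.toEquiv : Equiv.Perm X) ^ n : Equiv.Perm X) μ μ := by
  have hsymm : MeasurePreserving (((e.toEquiv : Equiv.Perm X))⁻¹ : Equiv.Perm X) μ μ := he.symm e
  induction n using Int.induction_on with
  | zero => exact MeasurePreserving.id μ
  | succ n ih =>
    rw [_root_.zpow_add_one]
    exact ih.comp he
  | pred n ih =>
    rw [_root_.zpow_sub_one]
    exact ih.comp hsymm

/-- If `e` raises the level function `φ` by `p` on the invariant set `S`, then the slab of `S`
on which `φ` lies in a half-open interval of length `p` is a fundamental domain for the group
generated by `e`. -/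
theorem isFundamentalDomain_levels {μ : Measure X} (e : X ≃ᵐ X)
    {S : Set X} (hSm : MeasurableSet S) (hSμ : ∀ᵐ x ∂μ, x ∈ S) {φ : X → ℝ} (hφm : Measurable φ)
    {p : ℝ} (hp : 0 < p) (hS : ∀ x, e x ∈ S ↔ x ∈ S) (hφ : ∀ x ∈ S, φ (e x) = φ x + p) (a : ℝ) :
    IsFundamentalDomain (Subgroup.zpowers (e.toEquiv : Equiv.Perm X))
      (S ∩ φ ⁻¹' Ico a (a + p)) μ := by
  have key := mem_and_level_zpow (e := e.toEquiv) hS hφ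
  refine ⟨(hSm.inter (hφm measurableSet_Ico)).nullMeasurableSet, ?_, ?_⟩
  · filter_upwards [hSμ] with x hx
    obtain ⟨m, hm, -⟩ := existsUnique_add_zsmul_mem_Ico hp (φ x) a
    refine ⟨⟨_, m, rfl⟩, (key m x hx).1, ?_⟩
    change φ ((e.toEquiv ^ m : Equiv.Perm X) x) ∈ Ico a (a + p)
    rw [(key m x hx).2]
    simpa using hm
  · rintro ⟨_, m, rfl⟩ ⟨_, n, rfl⟩ hne
    refine Disjoint.aedisjoint (Set.disjoint_left.2 ?_)
    rintro x ⟨y, ⟨hyS, hy⟩, hyx⟩ ⟨z, ⟨hzS, hz⟩, hzx⟩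
    have hyx' : (e.toEquiv ^ m : Equiv.Perm X) y = x := hyx
    have hzx' : (e.toEquiv ^ n : Equiv.Perm X) z = x := hzx
    have h1 := (key m y hyS).2
    have h2 := (key n z hzS).2
    rw [hyx'] at h1
    rw [hzx'] at h2
    have hmn : -m = -n := (existsUnique_add_zsmul_mem_Ico hp (φ x) a).unique
      (by simpa [h1] using hy) (by simpa [h2] using hz)
    exact hne (by rw [neg_injective hmn])

theorem setIntegral_levels_eq {μ : Measure X} (e : X ≃ᵐ X)
    (he : MeasurePreserving e μ μ) {S : Set X} (hSm : MeasurableSet S) (hSμ : ∀ᵐ x ∂μ, x ∈ S)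
    {φ ψ : X → ℝ} (hφm : Measurable φ) (hψm : Measurable ψ) {p : ℝ} (hp : 0 < p)
    (hS : ∀ x, e x ∈ S ↔ x ∈ S) (hφ : ∀ x ∈ S, φ (e x) = φ x + p)
    (hψ : ∀ x ∈ S, ψ (e x) = ψ x + p) (a b : ℝ) {f : X → ℝ} (hf : ∀ x, f (e x) = f x) :
    ∫ x in S ∩ φ ⁻¹' Ico a (a + p), f x ∂μ = ∫ x in S ∩ ψ ⁻¹' Ico b (b + p), f x ∂μ := by
  have : MeasurableConstSMul (Subgroup.zpowers (e.toEquiv : Equiv.Perm X)) X := by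
    refine ⟨?_⟩
    rintro ⟨_, n, rfl⟩
    exact (measurePreserving_zpow e he n).measurable
  have : SMulInvariantMeasure (Subgroup.zpowers (e.toEquiv : Equiv.Perm X)) X μ := by
    refine ⟨?_⟩
    rintro ⟨_, n, rfl⟩ s hs
    exact (measurePreserving_zpow e he n).measure_preimage hs.nullMeasurableSet
  refine (isFundamentalDomain_levels e hSm hSμ hφm hp hS hφ a).setIntegral_eq
    (isFundamentalDomain_levels e hSm hSμ hψm hp hS hψ b) ?_
  rintro ⟨_, n, rfl⟩ x
  exact (mem_and_level_zpow (e := e.toEquiv) (S := {y | f y = f x}) (φ := f) (p := 0)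
    (fun y => by simp [hf]) (fun y _ => by simp [hf]) n x rfl).1

end FundamentalDomain

theorem map_scale_volume {a b : ℝ} (ha : a ≠ 0) (hb : b ≠ 0) :
    Measure.map (fun y : ℝ × ℝ => (a * y.1, b * y.2)) volume
      = ENNReal.ofReal |(a * b)⁻¹| • volume := by
  have hdet : LinearMap.det (LinearMap.prodMap (a • LinearMap.id (R := ℝ) (M := ℝ))
      (b • LinearMap.id (R := ℝ) (M := ℝ))) = a * b := by
    rw [LinearMap.det_prodMap]
    simp
  have h := Measure.map_linearMap_addHaar_eq_smul_addHaar (volume : Measure (ℝ × ℝ))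
    (f := LinearMap.prodMap (a • LinearMap.id (R := ℝ) (M := ℝ))
      (b • LinearMap.id (R := ℝ) (M := ℝ))) (by rw [hdet]; exact mul_ne_zero ha hb)
  rw [hdet] at h
  exact h

/-- The coordinatewise scaling of the plane by nonzero factors. -/
def scaleEquiv {a b : ℝ} (ha : a ≠ 0) (hb : b ≠ 0) : (ℝ × ℝ) ≃ᵐ (ℝ × ℝ) :=
  (MeasurableEquiv.mulLeft₀ a ha).prodCongr (MeasurableEquiv.mulLeft₀ b hb)

theorem scaleEquiv_apply {a b : ℝ} (ha : a ≠ 0) (hb : b ≠ 0) (y : ℝ × ℝ) :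
    scaleEquiv ha hb y = (a * y.1, b * y.2) := rfl

theorem setIntegral_scale {a b : ℝ} (ha : 0 < a) (hb : 0 < b) (S : Set (ℝ × ℝ))
    (f : ℝ × ℝ → ℝ) :
    ∫ y in S, f y = a * b * ∫ y in {y : ℝ × ℝ | (a * y.1, b * y.2) ∈ S}, f (a * y.1, b * y.2) := by
  have h := (scaleEquiv ha.ne' hb.ne').measurableEmbedding.setIntegral_map (μ := volume) f S
  have h2 : Measure.map (scaleEquiv ha.ne' hb.ne') volume = ENNReal.ofReal |(a * b)⁻¹| • volume :=
    map_scale_volume ha.ne' hb.ne'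
  rw [h2, Measure.restrict_smul, integral_smul_measure,
    ENNReal.toReal_ofReal (abs_nonneg _), abs_of_pos (by positivity), smul_eq_mul] at h
  have h3 : ∫ y in {y : ℝ × ℝ | (a * y.1, b * y.2) ∈ S}, f (a * y.1, b * y.2)
      = (a * b)⁻¹ * ∫ y in S, f y := h.symm
  rw [h3]
  field_simp

/-- The open first quadrant. -/
def quadrant : Set (ℝ × ℝ) := {y | 0 < y.1 ∧ 0 < y.2}

theorem measurableSet_quadrant : MeasurableSet quadrant :=
  (measurableSet_lt measurable_const measurable_fst).inter
    (measurableSet_lt measurable_const measurable_snd)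

theorem setIntegral_quadrant_levels_eq {c : ℝ} (hc : 0 < c)
    {φ ψ : ℝ × ℝ → ℝ} (hφm : Measurable φ) (hψm : Measurable ψ) {p : ℝ} (hp : 0 < p)
    (hφ : ∀ y ∈ quadrant, φ (c * y.1, c⁻¹ * y.2) = φ y + p)
    (hψ : ∀ y ∈ quadrant, ψ (c * y.1, c⁻¹ * y.2) = ψ y + p) (a b : ℝ) {f : ℝ × ℝ → ℝ}
    (hf : ∀ y, f (c * y.1, c⁻¹ * y.2) = f y) :
    ∫ y in quadrant ∩ φ ⁻¹' Ico a (a + p), f y = ∫ y in quadrant ∩ ψ ⁻¹' Ico b (b + p), f y := by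
  have hci : 0 < c⁻¹ := inv_pos.2 hc
  set e := scaleEquiv hc.ne' hci.ne' with he
  have hQ : ∀ y, e y ∈ quadrant ↔ y ∈ quadrant := by
    intro y
    simp [he, scaleEquiv_apply, quadrant, hc]
  have hmp : MeasurePreserving e volume volume := by
    refine ⟨e.measurable, ?_⟩
    have h2 : Measure.map e volume = ENNReal.ofReal |(c * c⁻¹)⁻¹| • volume :=
      map_scale_volume hc.ne' hci.ne'
    rw [h2, mul_inv_cancel₀ hc.ne']
    simp
  have hmpr : MeasurePreserving e (volume.restrict quadrant) (volume.restrict quadrant) := by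
    have h3 := hmp.restrict_preimage measurableSet_quadrant
    have h4 : e ⁻¹' quadrant = quadrant := Set.ext hQ
    rwa [h4] at h3
  have h := setIntegral_levels_eq e hmpr measurableSet_quadrant
    (ae_restrict_mem measurableSet_quadrant) hφm hψm hp hQ hφ hψ a b hf
  rw [Measure.restrict_restrict (measurableSet_quadrant.inter (hφm measurableSet_Ico)),
    Measure.restrict_restrict (measurableSet_quadrant.inter (hψm measurableSet_Ico))] at h
  rwa [inter_right_comm, inter_self, inter_right_comm, inter_self] at h

theorem emb_mul (α β : Zsqrtd 2) : emb (α * β) = emb α * emb β := by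
  have h : Real.sqrt 2 * Real.sqrt 2 = 2 := Real.mul_self_sqrt (by norm_num)
  simp only [emb, Zsqrtd.re_mul, Zsqrtd.im_mul]
  push_cast
  linear_combination -((α.im : ℝ) * β.im) * h

theorem embc_mul (α β : Zsqrtd 2) : embc (α * β) = embc α * embc β := by
  have h : Real.sqrt 2 * Real.sqrt 2 = 2 := Real.mul_self_sqrt (by norm_num)
  simp only [embc, Zsqrtd.re_mul, Zsqrtd.im_mul]
  push_cast
  linear_combination -((α.im : ℝ) * β.im) * h

theorem one_lt_lam : 1 < lam := by
  have : 0 < Real.sqrt 2 := by positivity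
  unfold lam
  linarith

theorem lam_pos : 0 < lam := one_pos.trans one_lt_lam

theorem lam_inv : lam⁻¹ = Real.sqrt 2 - 1 := by
  have h : Real.sqrt 2 * Real.sqrt 2 = 2 := Real.mul_self_sqrt (by norm_num)
  refine inv_eq_of_mul_eq_one_right ?_
  unfold lam
  linear_combination h

/-- Every integral power of `λ` comes from a unit of `ℤ[√2]`. -/
theorem exists_emb_eq_lam_zpow (k : ℤ) :
    ∃ α : Zsqrtd 2, emb α = lam ^ k ∧ |embc α| = (lam ^ k)⁻¹ := by
  have hne := lam_pos.ne'
  have h1 : emb ⟨1, 1⟩ = lam := by simp [emb, lam]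
  have h2 : |embc ⟨1, 1⟩| = lam⁻¹ := by
    have : embc ⟨1, 1⟩ = -lam⁻¹ := by
      rw [lam_inv]
      simp [embc]
    rw [this, abs_neg, abs_of_pos (inv_pos.2 lam_pos)]
  have h3 : emb ⟨-1, 1⟩ = lam⁻¹ := by
    rw [lam_inv]
    simp [emb]
    ring
  have h4 : |embc ⟨-1, 1⟩| = lam := by
    have : embc ⟨-1, 1⟩ = -lam := by
      simp [embc, lam]
      ring
    rw [this, abs_neg, abs_of_pos lam_pos]
  induction k using Int.induction_on with
  | zero => exact ⟨1, by simp [emb], by simp [embc]⟩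
  | succ n ih =>
    obtain ⟨α, hα, hα'⟩ := ih
    refine ⟨α * ⟨1, 1⟩, ?_, ?_⟩
    · rw [emb_mul, hα, h1, zpow_add_one₀ hne]
    · rw [embc_mul, abs_mul, hα', h2, zpow_add_one₀ hne, mul_inv]
  | pred n ih =>
    obtain ⟨α, hα, hα'⟩ := ih
    refine ⟨α * ⟨-1, 1⟩, ?_, ?_⟩
    · rw [emb_mul, hα, h3, zpow_sub_one₀ hne]
    · rw [embc_mul, abs_mul, hα', h4, zpow_sub_one₀ hne, mul_inv, inv_inv]

theorem emb_neg (α : Zsqrtd 2) : emb (-α) = -emb α := by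
  simp [emb]
  ring

theorem embc_neg (α : Zsqrtd 2) : embc (-α) = -embc α := by
  simp [embc]
  ring

theorem thetaHat_pos : 0 < thetaHat := by
  unfold thetaHat
  positivity

theorem mem_ell1 {θ x : ℝ} : x ∈ ell1 θ ↔
    ∃ p ∈ T1, Real.sqrt thetaHat * x = p.1 * Real.cos θ - p.2 * Real.sin θ := by
  have h : Real.sqrt thetaHat ≠ 0 := (Real.sqrt_pos.2 thetaHat_pos).ne'
  simp only [ell1, mem_ofPred_eq, mul2, kmat, Real.cos_neg, Real.sin_neg]
  refine exists_congr fun p => and_congr_right fun _ => ?_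
  simp only [Prod.smul_fst, Prod.smul_snd, smul_eq_mul, of_apply, cons_val_zero, cons_val_one]
  constructor
  · rintro rfl
    field_simp
    ring
  · intro h'
    field_simp
    linarith

theorem mem_ell2 {θ x : ℝ} : x ∈ ell2 θ ↔
    ∃ p ∈ Woct, x = p.1 * Real.cos θ - p.2 * Real.sin θ := by
  simp only [ell2, mem_ofPred_eq, mul2, kmat, Real.cos_neg, Real.sin_neg]
  refine exists_congr fun p => and_congr_right fun _ => ?_
  simp [sub_eq_add_neg]

/-- The two windows, rescaled by `y`, meet no point of `𝓛'`. -/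
def Avoids (θ₁ θ₂ : ℝ) (y : ℝ × ℝ) : Prop :=
  Lp ∩ ((y.1⁻¹ • ell1 θ₁) ×ˢ (y.2⁻¹ • ell2 θ₂)) = ∅

theorem avoids_iff {θ₁ θ₂ : ℝ} {y : ℝ × ℝ} (hy : y ∈ quadrant) :
    Avoids θ₁ θ₂ y ↔ ∀ α : Zsqrtd 2, ¬ (emb α * y.1 ∈ ell1 θ₁ ∧ embc α * y.2 ∈ ell2 θ₂) := by
  have h1 : y.1⁻¹ ≠ 0 := inv_ne_zero hy.1.ne'
  have h2 : y.2⁻¹ ≠ 0 := inv_ne_zero hy.2.ne'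
  unfold Avoids
  rw [Set.eq_empty_iff_forall_notMem]
  constructor
  · rintro h α ⟨ha, hb⟩
    refine h (emb α, embc α) ⟨⟨α, rfl⟩, ?_, ?_⟩
    · rw [Set.mem_smul_set_iff_inv_smul_mem₀ h1]
      simpa [mul_comm] using ha
    · rw [Set.mem_smul_set_iff_inv_smul_mem₀ h2]
      simpa [mul_comm] using hb
  · rintro h _ ⟨⟨α, rfl⟩, ha, hb⟩
    rw [Set.mem_smul_set_iff_inv_smul_mem₀ h1] at ha
    rw [Set.mem_smul_set_iff_inv_smul_mem₀ h2] at hb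
    exact h α ⟨by simpa [mul_comm] using ha, by simpa [mul_comm] using hb⟩

theorem lam_sq_eq : lam ^ 2 = emb ⟨3, 2⟩ := by
  have h : Real.sqrt 2 * Real.sqrt 2 = 2 := Real.mul_self_sqrt (by norm_num)
  simp [lam, emb]
  linear_combination h

theorem lam_sq_inv_eq : (lam ^ 2)⁻¹ = embc ⟨3, 2⟩ := by
  have h : Real.sqrt 2 * Real.sqrt 2 = 2 := Real.mul_self_sqrt (by norm_num)
  rw [← inv_pow, lam_inv]
  simp [embc]
  linear_combination h

theorem avoids_scale_of_avoids {θ₁ θ₂ : ℝ} {y : ℝ × ℝ} (u v : Zsqrtd 2)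
    (hu : emb u * emb v = 1) (hv : embc u * embc v = 1) (h : Avoids θ₁ θ₂ y) :
    Avoids θ₁ θ₂ (emb u * y.1, embc u * y.2) := by
  have hu0 : emb u ≠ 0 := left_ne_zero_of_mul_eq_one hu
  have hv0 : embc u ≠ 0 := left_ne_zero_of_mul_eq_one hv
  unfold Avoids at h ⊢
  rw [Set.eq_empty_iff_forall_notMem] at h ⊢
  rintro _ ⟨⟨α, rfl⟩, ha, hb⟩
  refine h (emb (u * α), embc (u * α)) ⟨⟨_, rfl⟩, ?_, ?_⟩
  · obtain ⟨x, hx, hxα⟩ := ha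
    refine ⟨x, hx, ?_⟩
    simp only [smul_eq_mul] at hxα ⊢
    rw [emb_mul, ← hxα, mul_inv, ← mul_assoc, mul_inv_cancel_left₀ hu0]
  · obtain ⟨x, hx, hxα⟩ := hb
    refine ⟨x, hx, ?_⟩
    simp only [smul_eq_mul] at hxα ⊢
    rw [embc_mul, ← hxα, mul_inv, ← mul_assoc, mul_inv_cancel_left₀ hv0]

theorem avoids_scale_iff {θ₁ θ₂ : ℝ} {y : ℝ × ℝ} :
    Avoids θ₁ θ₂ (lam ^ 2 * y.1, (lam ^ 2)⁻¹ * y.2) ↔ Avoids θ₁ θ₂ y := by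
  have h : Real.sqrt 2 * Real.sqrt 2 = 2 := Real.mul_self_sqrt (by norm_num)
  have hu : emb ⟨3, 2⟩ * emb ⟨3, -2⟩ = 1 := by
    simp [emb]
    linear_combination -4 * h
  have hv : embc ⟨3, 2⟩ * embc ⟨3, -2⟩ = 1 := by
    simp [embc]
    linear_combination -4 * h
  rw [lam_sq_inv_eq, lam_sq_eq]
  refine ⟨fun h' => ?_, avoids_scale_of_avoids _ _ hu hv⟩
  have h2 := avoids_scale_of_avoids ⟨3, -2⟩ ⟨3, 2⟩ (by rwa [mul_comm]) (by rwa [mul_comm]) h'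
  rw [mul_comm] at hu hv
  simpa only [← mul_assoc, hu, hv, one_mul] using h2

theorem mem_ell2_of_abs_lt {θ x : ℝ} (hx : |x| < lam / Real.sqrt 2) : x ∈ ell2 θ := by
  have hcs := Real.cos_sq_add_sin_sq θ
  have hs2 : Real.sqrt 2 * Real.sqrt 2 = 2 := Real.mul_self_sqrt (by norm_num)
  have hs2' : 0 < Real.sqrt 2 := by positivity
  rw [mem_ell2]
  refine ⟨(x * Real.cos θ, -(x * Real.sin θ)), ⟨?_, ?_, ?_⟩, ?_⟩
  · simp only [abs_mul]
    exact (mul_le_of_le_one_right (abs_nonneg _) (Real.abs_cos_le_one θ)).trans_lt hx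
  · simp only [abs_neg, abs_mul]
    exact (mul_le_of_le_one_right (abs_nonneg _) (Real.abs_sin_le_one θ)).trans_lt hx
  · simp only [abs_neg, abs_mul]
    rw [lt_div_iff₀ hs2'] at hx
    have hsum : |Real.cos θ| + |Real.sin θ| ≤ Real.sqrt 2 := by
      refine Real.le_sqrt_of_sq_le ?_
      nlinarith [sq_nonneg (|Real.cos θ| - |Real.sin θ|), sq_abs (Real.cos θ),
        sq_abs (Real.sin θ)]
    nlinarith [abs_nonneg x]
  · linear_combination -x * hcs

theorem exists_mem_triangle {c s x : ℝ} (hs : 0 ≤ s) (hsc : s ≤ c) (h : c ^ 2 + s ^ 2 = 1)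
    (hx0 : 0 < x) (hx1 : x < 1) : ∃ u v : ℝ, 0 < u ∧ u < 1 ∧ |v| < u ∧ u * c - v * s = x := by
  have hcs : 1 ≤ c + s := by nlinarith [mul_nonneg hs (hs.trans hsc)]
  have hc1 : c ≤ 1 := by nlinarith
  have hs1 : s ≤ 1 := hsc.trans hc1
  have hc0 : 0 < c := by nlinarith
  have he : 0 < x * (1 - x) / 2 := by
    have := sub_pos.2 hx1
    positivity
  set ε := x * (1 - x) / 2 with hε
  have hεx : ε < x := by nlinarith
  have hε1 : ε < 1 - x := by nlinarith
  refine ⟨x * c + ε * s, ε * c - x * s, by positivity, ?_, ?_, ?_⟩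
  · nlinarith
  · rw [abs_lt]
    constructor
    · nlinarith [mul_le_mul_of_nonneg_left hsc hx0.le, mul_pos he hc0, mul_nonneg he.le hs]
    · nlinarith [mul_le_mul_of_nonneg_left hcs hx0.le, mul_le_mul_of_nonneg_left hc1 he.le,
        mul_nonneg he.le hs]
  · linear_combination x * h

theorem mem_ell1_of_mem_Jset {θ : ℝ} (hθ : θ ∈ Jset) :
    (∀ x, 0 < x → Real.sqrt thetaHat * x < 1 → x ∈ ell1 θ) ∨
      (∀ x, 0 < x → Real.sqrt thetaHat * x < 1 → -x ∈ ell1 θ) := by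
  have hpos := Real.sqrt_pos.2 thetaHat_pos
  have hcs := Real.cos_sq_add_sin_sq θ
  have hpi := Real.pi_pos
  have hle {c s : ℝ} (hc : 0 ≤ c) (h : s ^ 2 ≤ c ^ 2) : s ≤ c :=
    le_of_sq_le_sq h hc
  rcases hθ with ⟨h0, h1⟩ | ⟨h0, h1⟩
  · left
    intro x hx hx1
    have hs := Real.sin_nonneg_of_nonneg_of_le_pi h0 (by linarith)
    have hc := Real.cos_nonneg_of_neg_pi_div_two_le_of_le (x := θ) (by linarith) (by linarith)
    have h2 := Real.cos_nonneg_of_neg_pi_div_two_le_of_le (x := 2 * θ) (by linarith) (by linarith)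
    rw [Real.cos_two_mul] at h2
    obtain ⟨u, v, hu0, hu1, hv, huv⟩ := exists_mem_triangle hs
      (hle hc (by linarith)) hcs (by positivity) hx1
    exact mem_ell1.2 ⟨(u, v), ⟨hu0, hu1, hv⟩, huv.symm⟩
  · right
    intro x hx hx1
    have hs := Real.sin_nonneg_of_nonneg_of_le_pi (x := θ) (by linarith) h1.le
    have hc := Real.cos_nonneg_of_neg_pi_div_two_le_of_le (x := Real.pi - θ) (by linarith)
      (by linarith)
    have h2 := Real.cos_nonneg_of_neg_pi_div_two_le_of_le (x := 2 * (Real.pi - θ)) (by linarith)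
      (by linarith)
    rw [Real.cos_two_mul, Real.cos_pi_sub] at h2
    rw [Real.cos_pi_sub] at hc
    obtain ⟨u, v, hu0, hu1, hv, huv⟩ := exists_mem_triangle hs
      (hle hc (by linarith)) (by linarith) (by positivity) hx1
    exact mem_ell1.2 ⟨(u, -v), ⟨hu0, hu1, by simpa using hv⟩, by simp only; linarith⟩

theorem zero_mem_ell1_of_notMem_Jset {θ : ℝ} (hθ : θ ∈ Ico 0 Real.pi) (hJ : θ ∉ Jset) :
    0 ∈ ell1 θ := by
  have hpi := Real.pi_pos
  have hcs := Real.cos_sq_add_sin_sq θ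
  have h1 : Real.pi / 4 < θ := by
    by_contra h
    exact hJ (Or.inl ⟨hθ.1, not_lt.1 h⟩)
  have h2 : θ < 3 * Real.pi / 4 := by
    by_contra h
    exact hJ (Or.inr ⟨not_lt.1 h, hθ.2⟩)
  have hs : 0 < Real.sin θ := Real.sin_pos_of_pos_of_lt_pi (by linarith) hθ.2
  have h3 := Real.cos_neg_of_pi_div_two_lt_of_lt (x := 2 * θ) (by linarith) (by linarith)
  rw [Real.cos_two_mul] at h3
  have h4 : |Real.cos θ| < Real.sin θ := abs_lt_of_sq_lt_sq (by linarith) hs.le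
  refine mem_ell1.2 ⟨(1 / 2, Real.cos θ / (2 * Real.sin θ)), ⟨by norm_num, by norm_num, ?_⟩, ?_⟩
  · simp only [abs_div, abs_mul, abs_of_pos hs, abs_two]
    rw [div_lt_div_iff₀ (by positivity) (by norm_num)]
    linarith
  · field_simp
    ring

theorem not_avoids_of_notMem_Jset {θ₁ θ₂ : ℝ} (hθ : θ₁ ∈ Ico 0 Real.pi) (hJ : θ₁ ∉ Jset)
    {y : ℝ × ℝ} (hy : y ∈ quadrant) : ¬ Avoids θ₁ θ₂ y := by
  rw [avoids_iff hy]
  intro h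
  refine h 0 ⟨?_, ?_⟩
  · simpa [emb] using zero_mem_ell1_of_notMem_Jset hθ hJ
  · refine mem_ell2_of_abs_lt ?_
    have := lam_pos
    simp [embc]
    positivity

/-- For directions in `J`, windows that avoid `𝓛'` have bounded area. -/
theorem not_avoids_of_mul_lt {θ₁ θ₂ : ℝ} (hJ : θ₁ ∈ Jset) {y : ℝ × ℝ} (hy : y ∈ quadrant)
    (hlt : y.1 * y.2 * (Real.sqrt 2 * Real.sqrt thetaHat) < 1) : ¬ Avoids θ₁ θ₂ y := by
  obtain ⟨hy1, hy2⟩ := hy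
  have hpos := Real.sqrt_pos.2 thetaHat_pos
  have hs2 : 0 < Real.sqrt 2 := by positivity
  rw [avoids_iff ⟨hy1, hy2⟩]
  intro h
  obtain ⟨k, hk1, hk2⟩ := exists_mem_Ioc_zpow (x := (Real.sqrt thetaHat * y.1)⁻¹)
    (by positivity) one_lt_lam
  have hL := lam_pos
  have hlk : 0 < lam ^ k := zpow_pos hL k
  obtain ⟨α, hα, hα'⟩ := exists_emb_eq_lam_zpow k
  have hx : Real.sqrt thetaHat * (lam ^ k * y.1) < 1 := by
    rw [← one_div, lt_div_iff₀ (by positivity)] at hk1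
    linarith
  have hx2 : |embc α * y.2| < lam / Real.sqrt 2 := by
    rw [abs_mul, hα', abs_of_pos hy2, lt_div_iff₀ hs2, ← div_eq_inv_mul, div_mul_eq_mul_div,
      div_lt_iff₀ hlk]
    rw [zpow_add_one₀ hL.ne', inv_le_iff_one_le_mul₀ (by positivity)] at hk2
    have h3 : y.1 * (y.2 * Real.sqrt 2) * Real.sqrt thetaHat
        < y.1 * (lam * lam ^ k) * Real.sqrt thetaHat := by
      linarith
    have h4 := lt_of_mul_lt_mul_right h3 hpos.le
    exact lt_of_mul_lt_mul_left h4 hy1.le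
  rcases mem_ell1_of_mem_Jset hJ with h1 | h1
  · refine h α ⟨?_, mem_ell2_of_abs_lt hx2⟩
    rw [hα]
    exact h1 _ (by positivity) hx
  · refine h (-α) ⟨?_, mem_ell2_of_abs_lt ?_⟩
    · rw [emb_neg, neg_mul, hα]
      exact h1 _ (by positivity) hx
    · rwa [embc_neg, neg_mul, abs_neg]

theorem measureReal_Fdom : volume.real Fdom = 2 * Real.sqrt 2 := by
  have hs2 : 0 < Real.sqrt 2 := by positivity
  set L := Matrix.toLin (Module.Basis.finTwoProd ℝ) (Module.Basis.finTwoProd ℝ)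
    !![1, Real.sqrt 2; 1, -Real.sqrt 2] with hL
  have hdet : LinearMap.det L = -(2 * Real.sqrt 2) := by
    rw [hL, LinearMap.det_toLin, Matrix.det_fin_two_of]
    ring
  have hF : Fdom = (fun p => ((1 : ℝ), (2 : ℝ)) + p) '' (L '' (Ico (0:ℝ) 1 ×ˢ Ico (0:ℝ) 1)) := by
    rw [hL, Matrix.toLin_finTwoProd, Set.image_image]
    ext p
    constructor
    · rintro ⟨r₁, h₁, r₂, h₂, rfl⟩
      refine ⟨(r₁, r₂), ⟨h₁, h₂⟩, ?_⟩
      ext <;> simp <;> ring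
    · rintro ⟨⟨r₁, r₂⟩, ⟨h₁, h₂⟩, rfl⟩
      refine ⟨r₁, h₁, r₂, h₂, ?_⟩
      ext <;> simp <;> ring
  have hI : volume (Ico (0:ℝ) 1 ×ˢ Ico (0:ℝ) 1) = 1 := by
    rw [Measure.volume_eq_prod, Measure.prod_prod]
    simp
  rw [hF, Measure.real, Set.image_add_left, measure_preimage_add,
    Measure.addHaar_image_linearMap, hdet, hI, abs_neg, abs_of_pos (by positivity), mul_one,
    ENNReal.toReal_ofReal (by positivity)]

theorem volume_setOf_mul_eq_mul {a b : ℝ} (hb : b ≠ 0) :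
    volume {y : ℝ × ℝ | a * y.1 = b * y.2} = 0 := by
  have hm : MeasurableSet {y : ℝ × ℝ | a * y.1 = b * y.2} :=
    measurableSet_eq_fun (by fun_prop) (by fun_prop)
  rw [Measure.volume_eq_prod, Measure.measure_prod_null hm]
  refine Filter.Eventually.of_forall fun x => ?_
  refine measure_mono_null (t := {a * x / b}) (fun z hz => ?_) (by simp)
  have hz' : a * x = b * z := hz
  rw [Set.mem_singleton_iff, hz', mul_div_cancel_left₀ _ hb]

theorem volume_setOf_snd_eq (c : ℝ) : volume {y : ℝ × ℝ | y.2 = c} = 0 := by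
  have hm : MeasurableSet {y : ℝ × ℝ | y.2 = c} :=
    measurableSet_eq_fun (by fun_prop) (by fun_prop)
  rw [Measure.volume_eq_prod, Measure.measure_prod_null hm]
  refine Filter.Eventually.of_forall fun x => ?_
  exact measure_mono_null (t := {c}) (fun z hz => hz) (by simp)

/-- The sector of slopes between `λ⁻²` and `λ²` after scaling the axes by `a` and `b`. -/
def sector (a b : ℝ) : Set (ℝ × ℝ) :=
  {y | 0 < y.1 ∧ 0 < y.2 ∧ lam ^ (-2:ℤ) < a * y.1 / (b * y.2) ∧ a * y.1 / (b * y.2) < lam ^ 2}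

theorem setIntegral_sector_eq_setIntegral_Yset {a b : ℝ} (ha : 0 < a) (hb : 0 < b)
    {f : ℝ × ℝ → ℝ} (hf : ∀ y, f (lam ^ 2 * y.1, (lam ^ 2)⁻¹ * y.2) = f y) :
    ∫ y in sector a b, f y = ∫ y in Yset, f y := by
  have hL := lam_pos
  have hlog : 0 < Real.log lam := Real.log_pos one_lt_lam
  set φ : ℝ × ℝ → ℝ := fun y => (Real.log (a * y.1) - Real.log (b * y.2)) / 2 with hφ
  set ψ : ℝ × ℝ → ℝ := fun y => -Real.log y.2 with hψ
  have hinv : Real.log (lam ^ 2)⁻¹ = -(2 * Real.log lam) := by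
    rw [Real.log_inv, Real.log_pow]
    norm_num
  have hsq : Real.log (lam ^ 2) = 2 * Real.log lam := by
    rw [Real.log_pow]
    norm_num
  have hsector : (sector a b : Set (ℝ × ℝ)) =ᵐ[volume]
      (quadrant ∩ φ ⁻¹' Ico (-Real.log lam) (-Real.log lam + 2 * Real.log lam) : Set (ℝ × ℝ)) := by
    have h0 := measure_eq_zero_iff_ae_notMem.1
      (volume_setOf_mul_eq_mul (a := a) (b := lam ^ (-2:ℤ) * b)
        (by positivity))
    refine Filter.eventuallyEq_set.2 ?_
    filter_upwards [h0] with y hy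
    have hy' : ¬ a * y.1 = lam ^ (-2:ℤ) * b * y.2 := hy
    constructor
    · rintro ⟨h1, h2, h3, h4⟩
      refine ⟨⟨h1, h2⟩, ?_⟩
      have h5 := Real.log_lt_log (by positivity) h3
      have h6 := Real.log_lt_log (by positivity) h4
      rw [Real.log_div (by positivity) (by positivity)] at h5 h6
      rw [Real.log_zpow] at h5
      rw [hsq] at h6
      push_cast at h5
      constructor
      · simp only [hφ]; linarith
      · simp only [hφ]; linarith
    · rintro ⟨⟨h1, h2⟩, h3, h4⟩
      simp only [hφ] at h3 h4
      refine ⟨h1, h2, lt_of_le_of_ne ?_ ?_, ?_⟩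
      · rw [← Real.log_le_log_iff (by positivity) (by positivity),
          Real.log_div (by positivity) (by positivity), Real.log_zpow]
        push_cast
        linarith
      · intro h
        rw [eq_div_iff (by positivity)] at h
        exact hy' (by linarith)
      · rw [← Real.log_lt_log_iff (by positivity) (by positivity),
          Real.log_div (by positivity) (by positivity), hsq]
        linarith
  have hYset : (Yset : Set (ℝ × ℝ)) =ᵐ[volume]
      (quadrant ∩ ψ ⁻¹' Ico (-(2 * Real.log lam)) (-(2 * Real.log lam) + 2 * Real.log lam) :
        Set (ℝ × ℝ)) := by
    have h0 := measure_eq_zero_iff_ae_notMem.1 (volume_setOf_snd_eq (lam ^ 2))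
    refine Filter.eventuallyEq_set.2 ?_
    filter_upwards [h0] with y hy
    have hy' : ¬ y.2 = lam ^ 2 := hy
    constructor
    · rintro ⟨h1, h2, h3⟩
      have h4 : 0 < y.2 := one_pos.trans h2
      refine ⟨⟨h1, h4⟩, ?_⟩
      have h5 := Real.log_pos h2
      have h6 := Real.log_lt_log h4 h3
      rw [hsq] at h6
      constructor
      · simp only [hψ]; linarith
      · simp only [hψ]; linarith
    · rintro ⟨⟨h1, h2⟩, h3, h4⟩
      simp only [hψ] at h3 h4
      refine ⟨h1, ?_, lt_of_le_of_ne ?_ hy'⟩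
      · exact (Real.log_pos_iff h2.le).1 (by linarith)
      · rw [← Real.log_le_log_iff h2 (by positivity), hsq]
        linarith
  rw [setIntegral_congr_set hsector, setIntegral_congr_set hYset]
  refine setIntegral_quadrant_levels_eq (c := lam ^ 2) (by positivity) ?_ ?_
    (by positivity) ?_ ?_ _ _ hf
  · simp only [hφ]; fun_prop
  · simp only [hψ]; fun_prop
  · rintro y ⟨h1, h2⟩
    simp only [hφ]
    rw [mul_left_comm a, mul_left_comm b, Real.log_mul (by positivity) (by positivity),
      Real.log_mul (x := (lam ^ 2)⁻¹) (by positivity) (by positivity), hinv, hsq]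
    ring
  · rintro y ⟨h1, h2⟩
    simp only [hψ]
    rw [Real.log_mul (x := (lam ^ 2)⁻¹) (by positivity) (by positivity), hinv]
    ring

theorem exists_rotate_iff (θ X : ℝ) (S : ℝ × ℝ → Prop) :
    (∃ c, S (X * Real.cos θ + c * Real.sin θ, -(X * Real.sin θ) + c * Real.cos θ)) ↔
      ∃ p, S p ∧ X = p.1 * Real.cos θ - p.2 * Real.sin θ := by
  have hcs := Real.cos_sq_add_sin_sq θ
  constructor
  · rintro ⟨c, hc⟩
    exact ⟨_, hc, by linear_combination -X * hcs⟩
  · rintro ⟨p, hp, rfl⟩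
    refine ⟨p.1 * Real.sin θ + p.2 * Real.cos θ, ?_⟩
    convert hp using 1
    ext
    · linear_combination p.1 * hcs
    · linear_combination p.2 * hcs

theorem Tset_iff {s : ℝ} (hs : 0 < s) (p : ℝ × ℝ) :
    p ∈ Tset s ↔ (Real.sqrt thetaHat / Real.sqrt s) • p ∈ T1 := by
  have h1 := Real.sqrt_pos.2 thetaHat_pos
  have h2 := Real.sqrt_pos.2 hs
  have h3 : 0 < Real.sqrt thetaHat / Real.sqrt s := by positivity
  simp only [Tset, T1, mem_ofPred_eq, Prod.smul_fst, Prod.smul_snd, smul_eq_mul, abs_mul,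
    abs_of_pos h3, mul_lt_mul_iff_right₀ h3, mul_pos_iff_of_pos_left h3,
    Real.sqrt_div' _ thetaHat_pos.le]
  rw [lt_div_iff₀ h1, div_mul_eq_mul_div, div_lt_one h2, mul_comm]

theorem Ltilde_inter_calT_eq_empty_iff {s : ℝ} (hs : 0 < s) (r : ℤ) {θ₁ θ₂ : ℝ} {y : ℝ × ℝ}
    (hy : y ∈ quadrant) :
    Ltilde (Real.sqrt s * lam ^ (-(2 * r)) * y.1) (lam ^ (2 * r) * y.2) θ₁ θ₂ ∩ calT s r = ∅ ↔
      Avoids θ₁ θ₂ y := by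
  have hL := lam_pos
  have h1 := Real.sqrt_pos.2 thetaHat_pos
  have h2 := Real.sqrt_pos.2 hs
  have hz : 0 < lam ^ (2 * r) := zpow_pos hL _
  rw [avoids_iff hy, ← not_iff_not, ← Ne, ← Set.nonempty_iff_ne_empty]
  push Not
  rw [_root_.zpow_neg]
  set z := lam ^ (2 * r) with hzdef
  have key (α : Zsqrtd 2) : (emb α * y.1 ∈ ell1 θ₁ ∧ embc α * y.2 ∈ ell2 θ₂) ↔
      (∃ c₁, ((z * (emb α * (Real.sqrt s * z⁻¹ * y.1) * Real.cos θ₁ + c₁ * Real.sin θ₁),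
          z * (-(emb α * (Real.sqrt s * z⁻¹ * y.1) * Real.sin θ₁) + c₁ * Real.cos θ₁))
          ∈ Tset s)) ∧
      (∃ c₂, ((z⁻¹ * (embc α * (z * y.2) * Real.cos θ₂ + c₂ * Real.sin θ₂),
          z⁻¹ * (-(embc α * (z * y.2) * Real.sin θ₂) + c₂ * Real.cos θ₂)) ∈ Woct)) := by
    refine and_congr ?_ ?_
    · rw [exists_rotate_iff θ₁ _ (fun p => (z * p.1, z * p.2) ∈ Tset s), mem_ell1]
      simp only [Tset_iff hs]
      constructor
      · rintro ⟨p, hp, h⟩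
        refine ⟨(Real.sqrt s / (z * Real.sqrt thetaHat)) • p, ?_, ?_⟩
        · convert hp using 1
          ext <;> simp <;> field_simp
        · simp only [Prod.smul_fst, Prod.smul_snd, smul_eq_mul]
          field_simp
          linarith
      · rintro ⟨p, hp, h⟩
        refine ⟨_, hp, ?_⟩
        simp only [Prod.smul_fst, Prod.smul_snd, smul_eq_mul]
        field_simp at h ⊢
        linarith
    · rw [exists_rotate_iff θ₂ _ (fun p => (z⁻¹ * p.1, z⁻¹ * p.2) ∈ Woct), mem_ell2]
      constructor
      · rintro ⟨p, hp, h⟩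
        refine ⟨z • p, ?_, ?_⟩
        · convert hp using 1
          ext <;> simp [hz.ne']
        · simp only [Prod.smul_fst, Prod.smul_snd, smul_eq_mul]
          linear_combination z * h
      · rintro ⟨p, hp, h⟩
        refine ⟨_, hp, ?_⟩
        simp only
        field_simp
        linarith
  have hvec (c₁ c₂ X Z : ℝ) : Matrix.vecMul ![X, c₁, Z, c₂] (bd (kmat θ₁) (kmat θ₂))
      = ![X * Real.cos θ₁ + c₁ * Real.sin θ₁, -(X * Real.sin θ₁) + c₁ * Real.cos θ₁,
          Z * Real.cos θ₂ + c₂ * Real.sin θ₂, -(Z * Real.sin θ₂) + c₂ * Real.cos θ₂] := by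
    ext i
    fin_cases i <;> simp [Matrix.vecMul, dotProduct, Fin.sum_univ_four, bd, kmat]
  simp only [key]
  constructor
  · rintro ⟨_, ⟨m, n, c₁, c₂, rfl⟩, hT, hW⟩
    rw [hvec] at hT hW
    rw [_root_.zpow_neg] at hW
    exact ⟨⟨m, n⟩, ⟨c₁, hT⟩, ⟨c₂, hW⟩⟩
  · rintro ⟨⟨m, n⟩, ⟨c₁, hT⟩, ⟨c₂, hW⟩⟩
    refine ⟨_, ⟨m, n, c₁, c₂, rfl⟩, ?_⟩
    rw [hvec]
    refine ⟨hT, ?_⟩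
    rw [_root_.zpow_neg]
    exact hW

/-- The integrand on the right-hand side of the main theorem. -/
def weight (θ₁ θ₂ : ℝ) (y : ℝ × ℝ) : ℝ := (y.1 ^ 3 * y.2 ^ 3)⁻¹ * ind (Avoids θ₁ θ₂ y)

theorem weight_scale (θ₁ θ₂ : ℝ) (y : ℝ × ℝ) :
    weight θ₁ θ₂ (lam ^ 2 * y.1, (lam ^ 2)⁻¹ * y.2) = weight θ₁ θ₂ y := by
  have hL := lam_pos.ne'
  unfold weight
  rw [avoids_scale_iff]
  congr 2
  field_simp

theorem weight_eq_zero {θ₁ θ₂ : ℝ} {y : ℝ × ℝ} (h : ¬ Avoids θ₁ θ₂ y) : weight θ₁ θ₂ y = 0 := by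
  simp [weight, ind, h]

theorem measurableSet_sector (a b : ℝ) : MeasurableSet (sector a b) := by
  have h : Measurable fun y : ℝ × ℝ => a * y.1 / (b * y.2) := by fun_prop
  exact (measurableSet_lt measurable_const measurable_fst).inter
    ((measurableSet_lt measurable_const measurable_snd).inter
      ((measurableSet_lt measurable_const h).inter (measurableSet_lt h measurable_const)))

theorem setIntegral_Yt_eq {t s : ℝ} (hs : 0 < s) (θ₁ θ₂ : ℝ) :
    ∫ y in Yt t, (y.1 ^ 3 * y.2 ^ 3)⁻¹ * ind (Ltilde y.1 y.2 θ₁ θ₂ ∩ calTs s = ∅) =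
      s⁻¹ * ∫ y in sector (Real.sqrt s * lam ^ (-(2 * rr s))) (lam ^ (2 * rr s)) ∩
        {y | t ≤ Real.sqrt s * (y.1 * y.2)}, weight θ₁ θ₂ y := by
  have h2 := Real.sqrt_pos.2 hs
  have hz : 0 < lam ^ (2 * rr s) := zpow_pos lam_pos _
  have hz' : 0 < lam ^ (-(2 * rr s)) := zpow_pos lam_pos _
  have hzz : lam ^ (-(2 * rr s)) * lam ^ (2 * rr s) = 1 := by
    rw [_root_.zpow_neg, inv_mul_cancel₀ hz.ne']
  have hab : Real.sqrt s * lam ^ (-(2 * rr s)) * lam ^ (2 * rr s) = Real.sqrt s := by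
    rw [mul_assoc, hzz, mul_one]
  have ha : 0 < Real.sqrt s * lam ^ (-(2 * rr s)) := by positivity
  have hset : {y : ℝ × ℝ | (Real.sqrt s * lam ^ (-(2 * rr s)) * y.1, lam ^ (2 * rr s) * y.2) ∈ Yt t}
      = sector (Real.sqrt s * lam ^ (-(2 * rr s))) (lam ^ (2 * rr s)) ∩
        {y | t ≤ Real.sqrt s * (y.1 * y.2)} := by
    ext y
    have h3 : Real.sqrt s * lam ^ (-(2 * rr s)) * y.1 * (lam ^ (2 * rr s) * y.2)
        = Real.sqrt s * (y.1 * y.2) := by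
      linear_combination (Real.sqrt s * y.1 * y.2) * hzz
    simp only [Yt, sector, mem_ofPred_eq, Set.mem_inter_iff, mul_pos_iff_of_pos_left ha,
      mul_pos_iff_of_pos_left hz, h3]
    tauto
  rw [setIntegral_scale ha hz, hset, hab, ← integral_const_mul, ← integral_const_mul]
  have hm : MeasurableSet {y : ℝ × ℝ | t ≤ Real.sqrt s * (y.1 * y.2)} :=
    measurableSet_le measurable_const (by fun_prop)
  refine setIntegral_congr_fun ((measurableSet_sector _ _).inter hm) fun y hy => ?_
  have hq : y ∈ quadrant := ⟨hy.1.1, hy.1.2.1⟩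
  have hss : Real.sqrt s ^ 2 = s := Real.sq_sqrt hs.le
  simp only [weight]
  rw [calTs, Ltilde_inter_calT_eq_empty_iff hs _ hq, ← mul_pow, ← mul_pow]
  have h3 : Real.sqrt s * lam ^ (-(2 * rr s)) * y.1 * (lam ^ (2 * rr s) * y.2)
      = Real.sqrt s * (y.1 * y.2) := by
    linear_combination (Real.sqrt s * y.1 * y.2) * hzz
  rw [h3, ← hss, mul_pow, mul_inv]
  rw [← mul_assoc, ← mul_assoc, ← mul_assoc]
  congr 2
  field_simp
  rw [hss, hss]

theorem setIntegral_Yt_eq_zero {t s : ℝ} (hs : 0 < s) {θ₁ : ℝ} (hθ : θ₁ ∈ Ico 0 Real.pi)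
    (hJ : θ₁ ∉ Jset) (θ₂ : ℝ) :
    ∫ y in Yt t, (y.1 ^ 3 * y.2 ^ 3)⁻¹ * ind (Ltilde y.1 y.2 θ₁ θ₂ ∩ calTs s = ∅) = 0 := by
  rw [setIntegral_Yt_eq hs, setIntegral_eq_zero_of_forall_eq_zero, mul_zero]
  rintro y ⟨⟨h1, h2, -⟩, -⟩
  exact weight_eq_zero (not_avoids_of_notMem_Jset hθ hJ ⟨h1, h2⟩)

theorem setIntegral_Yt_eq_Yset {t s : ℝ} (ht : 0 < t) (hs : 0 < s) (hst : 2 * thetaHat * t ^ 2 ≤ s)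
    {θ₁ : ℝ} (hJ : θ₁ ∈ Jset) (θ₂ : ℝ) :
    ∫ y in Yt t, (y.1 ^ 3 * y.2 ^ 3)⁻¹ * ind (Ltilde y.1 y.2 θ₁ θ₂ ∩ calTs s = ∅) =
      s⁻¹ * ∫ y in Yset, weight θ₁ θ₂ y := by
  have h2 := Real.sqrt_pos.2 hs
  rw [setIntegral_Yt_eq hs, ← setIntegral_sector_eq_setIntegral_Yset
    (mul_pos h2 (zpow_pos lam_pos (-(2 * rr s)))) (zpow_pos lam_pos (2 * rr s))
    (weight_scale θ₁ θ₂)]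
  congr 1
  refine (setIntegral_eq_of_subset_of_forall_sdiff_eq_zero (measurableSet_sector _ _)
    inter_subset_left ?_).symm
  rintro y ⟨⟨h3, h4, h5⟩, hy⟩
  refine weight_eq_zero (not_avoids_of_mul_lt hJ ⟨h3, h4⟩ ?_)
  have hlt : Real.sqrt s * (y.1 * y.2) < t := by
    by_contra h
    exact hy ⟨⟨h3, h4, h5⟩, not_lt.1 h⟩
  have hle : Real.sqrt 2 * Real.sqrt thetaHat * t ≤ Real.sqrt s := by
    refine Real.le_sqrt_of_sq_le ?_
    rw [mul_pow, mul_pow, Real.sq_sqrt (by norm_num), Real.sq_sqrt thetaHat_pos.le]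
    exact hst
  have h6 : y.1 * y.2 * (Real.sqrt 2 * Real.sqrt thetaHat) * t < 1 * t := by
    nlinarith [mul_pos h3 h4]
  exact lt_of_mul_lt_mul_right h6 ht.le

theorem measurableSet_Jset : MeasurableSet Jset := measurableSet_Icc.union measurableSet_Ico

theorem Jset_subset_Ico : Jset ⊆ Ico 0 Real.pi := by
  have hpi := Real.pi_pos
  rintro θ (⟨h0, h1⟩ | ⟨h0, h1⟩)
  · exact ⟨h0, by linarith⟩
  · exact ⟨by linarith, h1⟩

theorem stmt6 : ∀ t > (0:ℝ), ∃ s₀ > (0:ℝ), ∀ s ≥ s₀,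
    GM t s = (2 * Real.sqrt 2 * cH / s) *
      ∫ θ₂ in Set.Ico (0:ℝ) Real.pi, ∫ θ₁ in Jset, ∫ y in Yset,
        (y.1 ^ 3 * y.2 ^ 3)⁻¹ *
          ind (Lp ∩ ((y.1⁻¹ • ell1 θ₁) ×ˢ (y.2⁻¹ • ell2 θ₂)) = ∅) := by
  intro t ht
  have hθ := thetaHat_pos
  refine ⟨2 * thetaHat * t ^ 2, by positivity, fun s hst => ?_⟩
  have hs : 0 < s := lt_of_lt_of_le (by positivity) hst
  have hinner (θ₂ : ℝ) : ∫ θ₁ in Set.Ico (0:ℝ) Real.pi, ∫ y in Yt t, ∫ x in Fdom,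
      (y.1 ^ 3 * y.2 ^ 3)⁻¹ * ind (Ltilde y.1 y.2 θ₁ θ₂ ∩ calTs s = ∅) =
      (2 * Real.sqrt 2 * s⁻¹) * ∫ θ₁ in Jset, ∫ y in Yset, weight θ₁ θ₂ y := by
    simp only [setIntegral_const, measureReal_Fdom, smul_eq_mul]
    simp only [integral_const_mul]
    rw [setIntegral_eq_of_subset_of_forall_sdiff_eq_zero measurableSet_Ico Jset_subset_Ico
      (fun θ h => setIntegral_Yt_eq_zero hs h.1 h.2 θ₂),
      setIntegral_congr_fun measurableSet_Jset
        (fun θ h => setIntegral_Yt_eq_Yset ht hs hst h θ₂), integral_const_mul]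
    ring
  change cH * _ = _ * ∫ θ₂ in Set.Ico (0:ℝ) Real.pi, ∫ θ₁ in Jset, ∫ y in Yset, weight θ₁ θ₂ y
  simp only [hinner]
  rw [integral_const_mul]
  field_simp

end
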